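/- (Corollary, part 1: the section σ′ also trivializes M_{n+1,+}) The map ι′ : GL_n(F) × (F^n × F^{n+1}) → M_{n+1}(F), (h,(a,b)) ↦ h·σ′(a,b), is a bijection onto M_{n+1,+}; i.e., for every X ∈ M_{n+1}(F) with Δ_+(X) ≠ 0 there exist a unique h ∈ GL_n(F) and a unique (a,b) ∈ F^n × F^{n+1} with X = h·σ′(a,b). -/

import Mathlib

open Matrix MeasureTheory

namespace ZhangRTF

variable {F : Type*} [Field F] {n : ℕ}

/-- Block diagonal embedding `diag(h,1) ∈ M_{n+1}(F)` of `h ∈ M_n(F)`. -/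
def emb (h : Matrix (Fin n) (Fin n) F) : Matrix (Fin (n + 1)) (Fin (n + 1)) F :=
  Matrix.of fun i j =>
    if hi : (i : ℕ) < n then
      (if hj : (j : ℕ) < n then h ⟨i, hi⟩ ⟨j, hj⟩ else 0)
    else (if (j : ℕ) < n then 0 else 1)

/-- Conjugation action of `GL_n(F)` on `M_{n+1}(F)`: `h·X = diag(h,1) X diag(h,1)⁻¹`. -/
def act (h : Matrix.GeneralLinearGroup (Fin n) F)
    (X : Matrix (Fin (n + 1)) (Fin (n + 1)) F) : Matrix (Fin (n + 1)) (Fin (n + 1)) F :=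
  emb (h : Matrix (Fin n) (Fin n) F) * X *
    emb ((h⁻¹ : Matrix.GeneralLinearGroup (Fin n) F) : Matrix (Fin n) (Fin n) F)

/-- The upper-left `n × n` block `A` of `X = [[A,u],[v,w]]`. -/
def blockA (X : Matrix (Fin (n + 1)) (Fin (n + 1)) F) : Matrix (Fin n) (Fin n) F :=
  Matrix.of fun i j => X i.castSucc j.castSucc

/-- The upper-right column `u` of `X = [[A,u],[v,w]]`. -/
def blockU (X : Matrix (Fin (n + 1)) (Fin (n + 1)) F) : Fin n → F :=
  fun i => X i.castSucc (Fin.last n)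

/-- The lower-left row `v` of `X = [[A,u],[v,w]]`. -/
def blockV (X : Matrix (Fin (n + 1)) (Fin (n + 1)) F) : Fin n → F :=
  fun j => X (Fin.last n) j.castSucc

/-- The lower-right corner `w` of `X = [[A,u],[v,w]]`. -/
def blockW (X : Matrix (Fin (n + 1)) (Fin (n + 1)) F) : F :=
  X (Fin.last n) (Fin.last n)

/-- `δ₊(X)`: the matrix whose `j`-th column is `A^{n-j} u` (`1 ≤ j ≤ n`, 1-indexed). -/
def deltaPlus (X : Matrix (Fin (n + 1)) (Fin (n + 1)) F) : Matrix (Fin n) (Fin n) F :=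
  Matrix.of fun i j => (blockA X ^ (n - 1 - (j : ℕ)) *ᵥ blockU X) i

/-- `δ₋(X)`: the matrix whose `i`-th row is `v A^{i-1}` (`1 ≤ i ≤ n`, 1-indexed). -/
def deltaMinus (X : Matrix (Fin (n + 1)) (Fin (n + 1)) F) : Matrix (Fin n) (Fin n) F :=
  Matrix.of fun i j => (blockV X ᵥ* blockA X ^ (i : ℕ)) j

/-- `Δ₊(X) = det δ₊(X)`. -/
def DeltaPlus (X : Matrix (Fin (n + 1)) (Fin (n + 1)) F) : F := (deltaPlus X).det

/-- `Δ₋(X) = det δ₋(X)`. -/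
def DeltaMinus (X : Matrix (Fin (n + 1)) (Fin (n + 1)) F) : F := (deltaMinus X).det

/-- The `a`-invariants: `a_i = -(coefficient of T^{n-i} in charpoly A)` (1-indexed). -/
noncomputable def aInv (X : Matrix (Fin (n + 1)) (Fin (n + 1)) F) : Fin n → F :=
  fun i => -((blockA X).charpoly.coeff (n - 1 - (i : ℕ)))

/-- The `b`-invariants: `b_0 = w` and `b_j = v A^{j-1} u` for `1 ≤ j ≤ n`. -/
def bInv (X : Matrix (Fin (n + 1)) (Fin (n + 1)) F) : Fin (n + 1) → F :=
  fun j => if (j : ℕ) = 0 then blockW X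
    else blockV X ⬝ᵥ (blockA X ^ ((j : ℕ) - 1) *ᵥ blockU X)

/-- The invariants map `π : M_{n+1}(F) → F^n × F^{n+1}`. -/
noncomputable def invMap (X : Matrix (Fin (n + 1)) (Fin (n + 1)) F) : (Fin n → F) × (Fin (n + 1) → F) :=
  (aInv X, bInv X)

/-- The regular nilpotent `ξ₊`: `(i,i+1)`-entries equal to `1`, all others `0`. -/
def xiPlus (n : ℕ) : Matrix (Fin (n + 1)) (Fin (n + 1)) F :=
  Matrix.of fun i j => if (j : ℕ) = (i : ℕ) + 1 then 1 else 0

/-- The section `σ(a,b)` of the invariants map. -/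
def sectSigma (a : Fin n → F) (b : Fin (n + 1) → F) : Matrix (Fin (n + 1)) (Fin (n + 1)) F :=
  Matrix.of fun i j =>
    if hi : (i : ℕ) < n then
      (if (j : ℕ) = 0 then a ⟨i, hi⟩ else 0) + (if (j : ℕ) = (i : ℕ) + 1 then 1 else 0)
    else b j.rev

/-- The variant section `σ'(a,b)`. -/
def sectSigma' (a : Fin n → F) (b : Fin (n + 1) → F) : Matrix (Fin (n + 1)) (Fin (n + 1)) F :=
  Matrix.of fun i j =>
    if (i : ℕ) < n - 1 then (if (j : ℕ) = (i : ℕ) + 1 then 1 else 0)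
    else if (i : ℕ) = n - 1 then
      (if hj : (j : ℕ) < n then a ⟨n - 1 - (j : ℕ), by omega⟩ else 1)
    else b j.rev

/-- Membership in `N_{n,-}`: lower triangular with unit diagonal. -/
def IsLowerUni (h : Matrix (Fin n) (Fin n) F) : Prop :=
  (∀ i, h i i = 1) ∧ ∀ i j : Fin n, i < j → h i j = 0

/-- Membership in `N_n`: upper triangular with unit diagonal. -/
def IsUpperUni (h : Matrix (Fin n) (Fin n) F) : Prop :=
  (∀ i, h i i = 1) ∧ ∀ i j : Fin n, j < i → h i j = 0

/-- Membership in the subvariety `𝒲`: superdiagonal entries `1`,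
entries above the superdiagonal `0`. -/
def memW (X : Matrix (Fin (n + 1)) (Fin (n + 1)) F) : Prop :=
  ∀ i j : Fin (n + 1),
    ((j : ℕ) = (i : ℕ) + 1 → X i j = 1) ∧ ((i : ℕ) + 1 < (j : ℕ) → X i j = 0)

/-- `p : 𝒲 → 𝒱`, replacing the last row by zero. -/
def pMap (X : Matrix (Fin (n + 1)) (Fin (n + 1)) F) : Matrix (Fin (n + 1)) (Fin (n + 1)) F :=
  Matrix.of fun i j => if (i : ℕ) = n then 0 else X i j

/-- `p' : 𝒲 → 𝒱'`, replacing the last row and the first column by zero. -/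
def pMap' (X : Matrix (Fin (n + 1)) (Fin (n + 1)) F) : Matrix (Fin (n + 1)) (Fin (n + 1)) F :=
  Matrix.of fun i j => if (i : ℕ) = n ∨ (j : ℕ) = 0 then 0 else X i j

/-- The determinant of an element of `GL_n(F)`, as a unit of `F`. -/
def GLdet (h : Matrix.GeneralLinearGroup (Fin n) F) : Fˣ :=
  Units.map Matrix.detMonoidHom h

end ZhangRTF

open ZhangRTF

namespace ZhangRTF

variable {F : Type*} [Field F] {n : ℕ}

lemma emb_cc (h : Matrix (Fin n) (Fin n) F) (i j : Fin n) :
    emb h i.castSucc j.castSucc = h i j := by simp [emb]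
lemma emb_cl (h : Matrix (Fin n) (Fin n) F) (i : Fin n) :
    emb h i.castSucc (Fin.last n) = 0 := by simp [emb]
lemma emb_lc (h : Matrix (Fin n) (Fin n) F) (j : Fin n) :
    emb h (Fin.last n) j.castSucc = 0 := by simp [emb]
lemma emb_ll (h : Matrix (Fin n) (Fin n) F) :
    emb h (Fin.last n) (Fin.last n) = 1 := by simp [emb]

lemma ext_blocks {X Y : Matrix (Fin (n + 1)) (Fin (n + 1)) F} :
    X = Y ↔ blockA X = blockA Y ∧ blockU X = blockU Y ∧ blockV X = blockV Y ∧
      blockW X = blockW Y := by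
  constructor
  · rintro rfl; simp
  · rintro ⟨hA, hU, hV, hW⟩
    ext i j
    refine Fin.lastCases ?_ (fun i => ?_) i <;> refine Fin.lastCases ?_ (fun j => ?_) j
    · exact hW
    · exact congrFun hV j
    · exact congrFun hU i
    · exact congrFun (congrFun hA i) j

lemma emb_mul (h k : Matrix (Fin n) (Fin n) F) : emb h * emb k = emb (h * k) := by
  rw [ext_blocks]
  refine ⟨?_, ?_, ?_, ?_⟩
  · ext i j
    simp [blockA, Matrix.mul_apply, Fin.sum_univ_castSucc, emb_cc, emb_cl, emb_lc]
  · ext i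
    simp [blockU, Matrix.mul_apply, Fin.sum_univ_castSucc, emb_cl]
  · ext i
    simp [blockV, Matrix.mul_apply, Fin.sum_univ_castSucc, emb_lc]
  · simp [blockW, Matrix.mul_apply, Fin.sum_univ_castSucc, emb_lc, emb_ll]

lemma emb_one : emb (1 : Matrix (Fin n) (Fin n) F) = 1 := by
  rw [ext_blocks]
  refine ⟨?_, ?_, ?_, ?_⟩
  · ext i j
    simp [blockA, emb_cc, Matrix.one_apply]
  · ext i
    simp [blockU, emb_cl, Matrix.one_apply]
  · ext i
    simp [blockV, emb_lc, Matrix.one_apply, (Fin.castSucc_lt_last i).ne']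
  · simp [blockW, emb_ll]

lemma act_iff (h : Matrix.GeneralLinearGroup (Fin n) F)
    (Y X : Matrix (Fin (n + 1)) (Fin (n + 1)) F) :
    act h Y = X ↔ (h : Matrix (Fin n) (Fin n) F) * blockA Y = blockA X * h ∧
      (h : Matrix (Fin n) (Fin n) F) *ᵥ blockU Y = blockU X ∧
      blockV Y = blockV X ᵥ* (h : Matrix (Fin n) (Fin n) F) ∧ blockW Y = blockW X := by
  have h1 : emb ((h⁻¹ : Matrix.GeneralLinearGroup (Fin n) F) : Matrix (Fin n) (Fin n) F) *
      emb (h : Matrix (Fin n) (Fin n) F) = 1 := by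
    rw [emb_mul, Units.inv_mul, emb_one]
  have h2 : emb (h : Matrix (Fin n) (Fin n) F) *
      emb ((h⁻¹ : Matrix.GeneralLinearGroup (Fin n) F) : Matrix (Fin n) (Fin n) F) = 1 := by
    rw [emb_mul, Units.mul_inv, emb_one]
  have h3 : act h Y = X ↔ emb (h : Matrix (Fin n) (Fin n) F) * Y = X * emb h := by
    unfold act
    constructor
    · rintro rfl
      rw [Matrix.mul_assoc _ _ (emb (h : Matrix (Fin n) (Fin n) F)), h1, Matrix.mul_one]
    · intro e
      rw [e, Matrix.mul_assoc, h2, Matrix.mul_one]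
  rw [h3, ext_blocks]
  have eA : blockA (emb (h : Matrix (Fin n) (Fin n) F) * Y) = h * blockA Y := by
    ext i j
    simp [blockA, Matrix.mul_apply, Fin.sum_univ_castSucc, emb_cc, emb_cl]
  have eA' : blockA (X * emb (h : Matrix (Fin n) (Fin n) F)) = blockA X * h := by
    ext i j
    simp [blockA, Matrix.mul_apply, Fin.sum_univ_castSucc, emb_cc, emb_lc]
  have eU : blockU (emb (h : Matrix (Fin n) (Fin n) F) * Y) = (h : Matrix (Fin n) (Fin n) F) *ᵥ blockU Y := by
    ext i
    simp [blockU, Matrix.mul_apply, Fin.sum_univ_castSucc, emb_cc, emb_cl, Matrix.mulVec,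
      dotProduct]
  have eU' : blockU (X * emb (h : Matrix (Fin n) (Fin n) F)) = blockU X := by
    ext i
    simp [blockU, Matrix.mul_apply, Fin.sum_univ_castSucc, emb_cl, emb_ll]
  have eV : blockV (emb (h : Matrix (Fin n) (Fin n) F) * Y) = blockV Y := by
    ext i
    simp [blockV, Matrix.mul_apply, Fin.sum_univ_castSucc, emb_lc, emb_ll]
  have eV' : blockV (X * emb (h : Matrix (Fin n) (Fin n) F)) = blockV X ᵥ* (h : Matrix (Fin n) (Fin n) F) := by
    ext i
    simp [blockV, Matrix.mul_apply, Fin.sum_univ_castSucc, emb_cc, emb_lc, Matrix.vecMul,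
      dotProduct]
  have eW : blockW (emb (h : Matrix (Fin n) (Fin n) F) * Y) = blockW Y := by
    simp [blockW, Matrix.mul_apply, Fin.sum_univ_castSucc, emb_lc, emb_ll]
  have eW' : blockW (X * emb (h : Matrix (Fin n) (Fin n) F)) = blockW X := by
    simp [blockW, Matrix.mul_apply, Fin.sum_univ_castSucc, emb_cl, emb_ll]
  rw [eA, eA', eU, eU', eV, eV', eW, eW']

/-- Intertwining passes to powers applied to the column vector. -/
lemma pow_intertwine (h A B : Matrix (Fin n) (Fin n) F) (u w : Fin n → F)
    (e : h * A = B * h) (eu : h *ᵥ u = w) (k : ℕ) :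
    h *ᵥ (A ^ k *ᵥ u) = B ^ k *ᵥ w := by
  have e' : h * A ^ k = B ^ k * h := (SemiconjBy.pow_right (a := h) (x := A) (y := B) e k)
  rw [Matrix.mulVec_mulVec, e', ← Matrix.mulVec_mulVec, eu]

lemma deltaPlus_mul (h : Matrix (Fin n) (Fin n) F) (Y X : Matrix (Fin (n + 1)) (Fin (n + 1)) F)
    (e : h * blockA Y = blockA X * h) (eu : h *ᵥ blockU Y = blockU X) :
    h * deltaPlus Y = deltaPlus X := by
  ext i j
  exact congrFun (pow_intertwine h _ _ _ _ e eu (n - 1 - (j : ℕ))) i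

/-- Companion matrix with first column `a`. -/
def comp (a : Fin n → F) : Matrix (Fin n) (Fin n) F :=
  Matrix.of fun i j => if (j : ℕ) = 0 then a i else if (i : ℕ) + 1 = j then 1 else 0

lemma blockA_mul_deltaPlus (X : Matrix (Fin (n + 1)) (Fin (n + 1)) F) (a : Fin n → F)
    (ha : blockA X ^ n *ᵥ blockU X = deltaPlus X *ᵥ a) :
    blockA X * deltaPlus X = deltaPlus X * comp a := by
  ext i j
  have hl : (blockA X * deltaPlus X) i j = (blockA X ^ (n - j) *ᵥ blockU X) i := by
    have : n - (j : ℕ) = (n - 1 - j) + 1 := by omega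
    rw [this, pow_succ', ← Matrix.mulVec_mulVec]
    rfl
  rw [hl]
  by_cases hj : (j : ℕ) = 0
  · rw [hj, Nat.sub_zero, ha]
    simp [Matrix.mul_apply, comp, hj, Matrix.mulVec, dotProduct]
  · have hj1 : (j : ℕ) - 1 < n := by omega
    rw [Matrix.mul_apply, Finset.sum_eq_single ⟨(j : ℕ) - 1, hj1⟩]
    · have e1 : (j : ℕ) - 1 + 1 = j := by omega
      have e2 : n - 1 - ((j : ℕ) - 1) = n - j := by omega
      simp [comp, hj, e1, deltaPlus, e2]
    · intro k _ hk
      have : (k : ℕ) + 1 ≠ j := fun h => hk (Fin.ext (by simp; omega))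
      simp [comp, hj, this]
    · simp

/-- Reversed standard basis vectors. -/
def revE (n : ℕ) (F : Type*) [Field F] (k : ℕ) : Fin n → F :=
  fun i => if (i : ℕ) + k + 1 = n then 1 else 0

lemma blockU_sigma (a : Fin n → F) (b : Fin (n + 1) → F) :
    blockU (sectSigma' a b) = revE n F 0 := by
  ext i
  have := i.2
  simp only [blockU, sectSigma', revE, Matrix.of_apply, Fin.val_castSucc, Fin.val_last]
  split_ifs <;> first | rfl | omega

lemma blockA_sigma_lt (a : Fin n → F) (b : Fin (n + 1) → F) (w : Fin n → F) (i : Fin n)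
    (hi : (i : ℕ) + 1 < n) : (blockA (sectSigma' a b) *ᵥ w) i = w ⟨i + 1, hi⟩ := by
  have h' : (i : ℕ) < n - 1 := by omega
  simp only [Matrix.mulVec, dotProduct, blockA, sectSigma', Matrix.of_apply, Fin.val_castSucc,
    h', if_true]
  rw [Finset.sum_eq_single ⟨(i : ℕ) + 1, hi⟩]
  · simp
  · intro k _ hk
    have : (k : ℕ) ≠ i + 1 := fun h => hk (Fin.ext h)
    simp [this]
  · simp

lemma blockA_sigma_revE (a : Fin n → F) (b : Fin (n + 1) → F) (k : ℕ) (hk : k < n) :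
    blockA (sectSigma' a b) *ᵥ revE n F k = revE n F (k + 1) + a ⟨k, hk⟩ • revE n F 0 := by
  ext i
  by_cases hi : (i : ℕ) + 1 < n
  · rw [blockA_sigma_lt a b _ i hi]
    simp only [revE, Pi.add_apply, Pi.smul_apply, smul_eq_mul]
    split_ifs <;> first | omega | simp
  · have hi' : (i : ℕ) = n - 1 := by omega
    have hn : 0 < n := by omega
    simp only [Matrix.mulVec, dotProduct]
    rw [Finset.sum_eq_single ⟨n - 1 - k, by omega⟩]
    · have e1 : n - 1 - (n - 1 - k) = k := by omega
      have e2 : n - 1 - k + k + 1 = n := by omega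
      have e3 : n - 1 - k < n := by omega
      have e4 : n - 1 + 1 = n := by omega
      have e5 : ¬ (n - 1 + (k + 1) + 1 = n) := by omega
      simp [blockA, sectSigma', revE, hi', e1, e2, e3, e4, e5]
    · intro j _ hj
      have : ¬ ((j : ℕ) + k + 1 = n) := fun h => hj (Fin.ext (by simp; omega))
      simp [revE, this]
    · simp

lemma sigma_rel (a : Fin n → F) (b : Fin (n + 1) → F) :
    blockA (sectSigma' a b) ^ n *ᵥ blockU (sectSigma' a b) = deltaPlus (sectSigma' a b) *ᵥ a := by
  let a' : ℕ → F := fun i => if h : i < n then a ⟨i, h⟩ else 0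
  set A := blockA (sectSigma' a b) with hA
  have key : ∀ k ≤ n, A ^ k *ᵥ revE n F 0 =
      revE n F k + ∑ i ∈ Finset.range k, a' i • (A ^ (k - 1 - i) *ᵥ revE n F 0) := by
    intro k
    induction k with
    | zero => intro _; simp
    | succ k ih =>
      intro hk
      rw [pow_succ', ← Matrix.mulVec_mulVec, ih (by omega), Matrix.mulVec_add,
        blockA_sigma_revE a b k (by omega), Finset.sum_range_succ, Matrix.mulVec_sum]
      have e : ∀ i ∈ Finset.range k, A *ᵥ (a' i • (A ^ (k - 1 - i) *ᵥ revE n F 0)) =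
          a' i • (A ^ (k + 1 - 1 - i) *ᵥ revE n F 0) := by
        intro i hi
        have hi := Finset.mem_range.1 hi
        have : k + 1 - 1 - i = (k - 1 - i) + 1 := by omega
        rw [this, pow_succ', ← Matrix.mulVec_mulVec, Matrix.mulVec_smul]
      rw [Finset.sum_congr rfl e]
      have e0 : a' k = a ⟨k, by omega⟩ := by
        have : k < n := by omega
        simp [a', this]
      have e1 : k + 1 - 1 - k = 0 := by omega
      rw [e0, e1, pow_zero, Matrix.one_mulVec]
      abel
  have := key n le_rfl
  rw [blockU_sigma, this]
  ext i
  have h0 : revE n F n i = 0 := by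
    have : ¬ ((i : ℕ) + n + 1 = n) := by omega
    simp [revE, this]
  rw [Pi.add_apply, h0, zero_add, Finset.sum_range, Finset.sum_apply]
  simp only [Matrix.mulVec, dotProduct]
  refine Finset.sum_congr rfl fun j _ => ?_
  have : a' j = a j := by simp [a']
  rw [Pi.smul_apply, this, smul_eq_mul, mul_comm]
  simp only [deltaPlus, Matrix.of_apply, blockU_sigma]
  rfl

lemma sigma_tri (a : Fin n → F) (b : Fin (n + 1) → F) (k : ℕ) : ∀ i : Fin n,
    (i : ℕ) + k + 1 ≤ n → (blockA (sectSigma' a b) ^ k *ᵥ revE n F 0) i =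
      if (i : ℕ) + k + 1 = n then 1 else 0 := by
  induction k with
  | zero => intro i _; simp [revE]
  | succ k ih =>
    intro i hi
    rw [pow_succ', ← Matrix.mulVec_mulVec, blockA_sigma_lt a b _ i (by omega), ih _ (by simp; omega)]
    have : (i : ℕ) + 1 + k + 1 = i + (k + 1) + 1 := by omega
    simp only [this]

lemma DeltaPlus_sigma (a : Fin n → F) (b : Fin (n + 1) → F) :
    (deltaPlus (sectSigma' a b)).det = 1 := by
  rw [Matrix.det_of_lowerTriangular]
  · refine Finset.prod_eq_one fun i _ => ?_
    simp only [deltaPlus, Matrix.of_apply, blockU_sigma]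
    rw [sigma_tri _ _ _ _ (by omega), if_pos (by omega)]
  · intro i j hij
    have hij : i < j := hij
    have : (i : ℕ) < j := hij
    simp only [deltaPlus, Matrix.of_apply, blockU_sigma]
    rw [sigma_tri _ _ _ _ (by omega), if_neg (by omega)]

lemma blockV_sigma (hn : 1 ≤ n) (a : Fin n → F) (b : Fin (n + 1) → F) (j : Fin n) :
    blockV (sectSigma' a b) j = b j.castSucc.rev := by
  have h1 : ¬ (n < n - 1) := by omega
  have h2 : ¬ (n = n - 1) := by omega
  simp only [blockV, sectSigma', Matrix.of_apply, Fin.val_last, if_neg h1, if_neg h2]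

lemma blockW_sigma (hn : 1 ≤ n) (a : Fin n → F) (b : Fin (n + 1) → F) :
    blockW (sectSigma' a b) = b (Fin.last n).rev := by
  have h1 : ¬ (n < n - 1) := by omega
  have h2 : ¬ (n = n - 1) := by omega
  simp only [blockW, sectSigma', Matrix.of_apply, Fin.val_last, if_neg h1, if_neg h2]

lemma deltaPlus_sigma_indep (a : Fin n → F) (b b' : Fin (n + 1) → F) :
    blockA (sectSigma' a b) = blockA (sectSigma' a b') := by
  ext i j
  have := i.2
  simp only [blockA, sectSigma', Matrix.of_apply, Fin.val_castSucc]
  split_ifs <;> first | rfl | omega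

lemma deltaPlus_sigma_indep' (a : Fin n → F) (b b' : Fin (n + 1) → F) :
    deltaPlus (sectSigma' a b) = deltaPlus (sectSigma' a b') := by
  unfold deltaPlus
  rw [deltaPlus_sigma_indep a b b', blockU_sigma, blockU_sigma]

lemma deltaPlus_last (hn : 1 ≤ n) (X : Matrix (Fin (n + 1)) (Fin (n + 1)) F) :
    deltaPlus X *ᵥ revE n F 0 = blockU X := by
  ext i
  simp only [Matrix.mulVec, dotProduct]
  rw [Finset.sum_eq_single ⟨n - 1, by omega⟩]
  · have : n - 1 + 1 = n := by omega
    simp [deltaPlus, revE, this]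
  · intro j _ hj
    have : ¬ ((j : ℕ) + 0 + 1 = n) := fun h => hj (Fin.ext (by simp; omega))
    simp [revE, this]
  · simp

end ZhangRTF

/-- The map `(h,(a,b)) ↦ h·σ'(a,b)` is a bijection onto `M_{n+1,+}`. -/
theorem sigma'_trivialization (n : ℕ) (hn : 1 ≤ n) (F : Type*) [Field F] :
    (∀ (h : Matrix.GeneralLinearGroup (Fin n) F) (a : Fin n → F) (b : Fin (n + 1) → F),
      DeltaPlus (act h (sectSigma' a b)) ≠ 0) ∧
    (∀ X : Matrix (Fin (n + 1)) (Fin (n + 1)) F, DeltaPlus X ≠ 0 →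
      ∃! p : Matrix.GeneralLinearGroup (Fin n) F × ((Fin n → F) × (Fin (n + 1) → F)),
        act p.1 (sectSigma' p.2.1 p.2.2) = X) := by
  constructor
  · intro h a b
    obtain ⟨e, eu, -, -⟩ := (act_iff h (sectSigma' a b) _).1 rfl
    unfold DeltaPlus
    rw [← deltaPlus_mul _ _ _ e eu, Matrix.det_mul, DeltaPlus_sigma, mul_one]
    exact ((Matrix.isUnit_iff_isUnit_det _).1 h.isUnit).ne_zero
  · intro X hX
    have hXu : IsUnit (deltaPlus X).det := isUnit_iff_ne_zero.2 hX
    have uniqA : ∀ (h : Matrix.GeneralLinearGroup (Fin n) F) (a : Fin n → F)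
        (b : Fin (n + 1) → F), act h (sectSigma' a b) = X →
        a = (deltaPlus X)⁻¹ *ᵥ (blockA X ^ n *ᵥ blockU X) := by
      intro h a b hab
      obtain ⟨e, eu, -, -⟩ := (act_iff h _ _).1 hab
      rw [← pow_intertwine _ _ _ _ _ e eu n, sigma_rel,
        Matrix.mulVec_mulVec a (h : Matrix (Fin n) (Fin n) F),
        deltaPlus_mul _ _ _ e eu, Matrix.mulVec_mulVec, Matrix.nonsing_inv_mul _ hXu,
        Matrix.one_mulVec]
    set a := (deltaPlus X)⁻¹ *ᵥ (blockA X ^ n *ᵥ blockU X) with ha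
    have ha' : blockA X ^ n *ᵥ blockU X = deltaPlus X *ᵥ a := by
      rw [ha, Matrix.mulVec_mulVec, Matrix.mul_nonsing_inv _ hXu, Matrix.one_mulVec]
    set D := deltaPlus (sectSigma' a (0 : Fin (n + 1) → F)) with hD
    have hDu : IsUnit D.det := by rw [hD, DeltaPlus_sigma]; exact isUnit_one
    have hHu : IsUnit (deltaPlus X * D⁻¹) := by
      rw [Matrix.isUnit_iff_isUnit_det, Matrix.det_mul]
      exact hXu.mul (Matrix.isUnit_nonsing_inv_det _ hDu)
    obtain ⟨h, hh⟩ := hHu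
    let r : Fin (n + 1) → F :=
      Fin.snoc (α := fun _ => F) (blockV X ᵥ* (h : Matrix (Fin n) (Fin n) F)) (blockW X)
    refine ⟨(h, a, fun j => r j.rev), ?_, ?_⟩
    · refine (act_iff _ _ _).2 ?_
      have hDD : D = deltaPlus (sectSigma' a fun j => r j.rev) := deltaPlus_sigma_indep' _ _ _
      refine ⟨?_, ?_, ?_, ?_⟩
      · have e1 := blockA_mul_deltaPlus X a ha'
        have e2 := blockA_mul_deltaPlus _ a (sigma_rel a (fun j => r j.rev))
        rw [← hDD] at e2
        dsimp only
        set A := blockA (sectSigma' a fun j => r j.rev)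
        rw [hh]
        calc deltaPlus X * D⁻¹ * A = deltaPlus X * D⁻¹ * (A * (D * D⁻¹)) := by
              rw [Matrix.mul_nonsing_inv _ hDu, Matrix.mul_one]
          _ = deltaPlus X * D⁻¹ * ((A * D) * D⁻¹) := by rw [Matrix.mul_assoc A]
          _ = deltaPlus X * (D⁻¹ * D) * comp a * D⁻¹ := by
              rw [e2]; simp only [Matrix.mul_assoc]
          _ = (deltaPlus X * comp a) * D⁻¹ := by
              rw [Matrix.nonsing_inv_mul _ hDu, Matrix.mul_one]
          _ = blockA X * (deltaPlus X * D⁻¹) := by rw [← e1, Matrix.mul_assoc]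
      · have e := deltaPlus_last hn (sectSigma' a fun j => r j.rev)
        rw [← hDD] at e
        dsimp only
        rw [← e, hh, Matrix.mulVec_mulVec, Matrix.mul_assoc, Matrix.nonsing_inv_mul _ hDu,
          Matrix.mul_one, deltaPlus_last hn]
      · ext j
        dsimp only
        rw [blockV_sigma hn, Fin.rev_rev]
        simp [r]
      · dsimp only
        rw [blockW_sigma hn, Fin.rev_rev]
        simp [r]
    · rintro ⟨h', a', b'⟩ hp
      dsimp only at hp
      have haa : a' = a := uniqA _ _ _ hp
      subst haa
      obtain ⟨e, eu, ev, ew⟩ := (act_iff h' _ _).1 hp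
      have e3 := deltaPlus_mul _ _ _ e eu
      rw [deltaPlus_sigma_indep' _ b' 0, ← hD] at e3
      have hhh : h' = h := by
        apply Units.ext
        rw [hh, ← e3, Matrix.mul_assoc, Matrix.mul_nonsing_inv _ hDu, Matrix.mul_one]
      subst hhh
      refine Prod.ext rfl (Prod.ext rfl ?_)
      funext j
      dsimp only
      obtain ⟨k, rfl⟩ : ∃ k : Fin (n + 1), j = k.rev := ⟨j.rev, by simp⟩
      rw [Fin.rev_rev]
      refine Fin.lastCases ?_ (fun k => ?_) k
      · rw [← blockW_sigma hn a b', ew]; simp [r]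
      · rw [← blockV_sigma hn a b', ev]; simp [r]
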